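/- arXiv:0806.3310 — 2 statements merged into one kernel-verified Lean document; each statement's English description precedes it below -/
import Mathlib

section
/- F-regular functions are analytic: Let Ω ⊆ ℍ be an open set and let f : ℍ → ℍ be continuously differentiable on Ω with D_l f = 0 on Ω. Then f is real-analytic on Ω (analytic as a map between the real normed spaces ℍ and ℍ). -/
open MeasureTheory Metric Filter
open scoped Quaternion Topology

noncomputable section

/-- Borel measurable structure on the quaternions `ℍ ≅ ℝ⁴`. -/
instance : MeasurableSpace ℍ[ℝ] := borel _
instance : BorelSpace ℍ[ℝ] := ⟨rfl⟩

/-- Lebesgue measure on `ℍ ≅ ℝ⁴`, i.e. the Haar measure normalized so that the unit cube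
of an orthonormal basis has volume one. -/
instance : MeasureSpace ℍ[ℝ] := ⟨(stdOrthonormalBasis ℝ ℍ[ℝ]).toBasis.addHaar⟩

/-- The imaginary unit `i` of `ℍ`. -/
def qI : ℍ[ℝ] := ⟨0, 1, 0, 0⟩
/-- The imaginary unit `j` of `ℍ`. -/
def qJ : ℍ[ℝ] := ⟨0, 0, 1, 0⟩
/-- The imaginary unit `k` of `ℍ`. -/
def qK : ℍ[ℝ] := ⟨0, 0, 0, 1⟩

/-- The left Fueter operator `D_l f = ∂f/∂t + i·∂f/∂x + j·∂f/∂y + k·∂f/∂z`. -/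
def Dl (f : ℍ[ℝ] → ℍ[ℝ]) (q : ℍ[ℝ]) : ℍ[ℝ] :=
  fderiv ℝ f q 1 + qI * fderiv ℝ f q qI + qJ * fderiv ℝ f q qJ + qK * fderiv ℝ f q qK

/-- The right Fueter operator `D_r f = ∂f/∂t + (∂f/∂x)·i + (∂f/∂y)·j + (∂f/∂z)·k`. -/
def Dr (f : ℍ[ℝ] → ℍ[ℝ]) (q : ℍ[ℝ]) : ℍ[ℝ] :=
  fderiv ℝ f q 1 + fderiv ℝ f q qI * qI + fderiv ℝ f q qJ * qJ + fderiv ℝ f q qK * qK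

/-- The Cauchy–Fueter kernel `E(q,p) = (1/(2π²))·(q−p)⁻¹/|q−p|²`. -/
def E (q p : ℍ[ℝ]) : ℍ[ℝ] := ((2 * Real.pi ^ 2)⁻¹ * (‖q - p‖ ^ 2)⁻¹) • (q - p)⁻¹

/-- A test function on a bounded open set `Ω ⊆ ℍ`: a smooth function with compact
support contained in `Ω`. -/
structure IsTestFunction (φ : ℍ[ℝ] → ℍ[ℝ]) (Ω : Set ℍ[ℝ]) : Prop where
  smooth : ContDiff ℝ (⊤ : ℕ∞) φ
  compact_supp : HasCompactSupport φ
  supp_subset : tsupport φ ⊆ Ω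

instance : StarModule ℝ ℍ[ℝ] := ⟨fun r q ↦ by ext <;> simp⟩

@[simp] theorem re_qI : qI.re = 0 := rfl
@[simp] theorem imI_qI : qI.imI = 1 := rfl
@[simp] theorem imJ_qI : qI.imJ = 0 := rfl
@[simp] theorem imK_qI : qI.imK = 0 := rfl
@[simp] theorem re_qJ : qJ.re = 0 := rfl
@[simp] theorem imI_qJ : qJ.imI = 0 := rfl
@[simp] theorem imJ_qJ : qJ.imJ = 1 := rfl
@[simp] theorem imK_qJ : qJ.imK = 0 := rfl
@[simp] theorem re_qK : qK.re = 0 := rfl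
@[simp] theorem imI_qK : qK.imI = 0 := rfl
@[simp] theorem imJ_qK : qK.imJ = 0 := rfl
@[simp] theorem imK_qK : qK.imK = 1 := rfl

/-- A regularization of the Cauchy–Fueter kernel `p ↦ star p / ‖p‖ ^ 4`, without its
normalizing constant. -/
def regKernel (δ : ℝ) (p : ℍ[ℝ]) : ℍ[ℝ] := ((‖p‖ ^ 2 + δ ^ 2) ^ 2)⁻¹ • star p

theorem hasFDerivAt_regKernel {δ : ℝ} (hδ : δ ≠ 0) (p : ℍ[ℝ]) :
    HasFDerivAt (regKernel δ)
      (((‖p‖ ^ 2 + δ ^ 2) ^ 2)⁻¹ • ((starL' ℝ : ℍ[ℝ] ≃L[ℝ] ℍ[ℝ]) : ℍ[ℝ] →L[ℝ] ℍ[ℝ]) +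
        ((-4 * ((‖p‖ ^ 2 + δ ^ 2) ^ 3)⁻¹) • innerSL ℝ p).smulRight (star p)) p := by
  have hpos : 0 < ‖p‖ ^ 2 + δ ^ 2 := by positivity
  have h1 : HasFDerivAt (fun p : ℍ[ℝ] ↦ ‖p‖ ^ 2 + δ ^ 2) (2 • innerSL ℝ p) p :=
    (hasStrictFDerivAt_norm_sq p).hasFDerivAt.add_const _
  have h2 : HasDerivAt (fun t : ℝ ↦ (t ^ 2)⁻¹) (-2 * ((‖p‖ ^ 2 + δ ^ 2) ^ 3)⁻¹)
      (‖p‖ ^ 2 + δ ^ 2) := by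
    refine ((hasDerivAt_pow 2 _).inv (by positivity)).congr_deriv ?_
    field_simp
    push_cast
    ring
  have h3 := h2.comp_hasFDerivAt p h1
  refine (h3.smul (starL' ℝ : ℍ[ℝ] ≃L[ℝ] ℍ[ℝ]).hasFDerivAt).congr_fderiv ?_
  ext1 v
  simp only [_root_.add_apply, _root_.smul_apply,
    ContinuousLinearMap.smulRight_apply, Function.comp]
  congr 2
  simp only [smul_eq_mul, nsmul_eq_mul]
  push_cast
  ring

theorem contDiff_regKernel {δ : ℝ} (hδ : δ ≠ 0) : ContDiff ℝ 1 (regKernel δ) := by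
  unfold regKernel
  refine ContDiff.smul (ContDiff.inv (((contDiff_norm_sq ℝ).add contDiff_const).pow 2) ?_)
    (starL' ℝ : ℍ[ℝ] ≃L[ℝ] ℍ[ℝ]).contDiff
  intro p
  positivity

theorem Dr_regKernel {δ : ℝ} (hδ : δ ≠ 0) (p : ℍ[ℝ]) :
    Dr (regKernel δ) p = ((4 * δ ^ 2 * ((‖p‖ ^ 2 + δ ^ 2) ^ 3)⁻¹ : ℝ) : ℍ[ℝ]) := by
  have hpos : 0 < ‖p‖ ^ 2 + δ ^ 2 := by positivity
  have hn : ‖p‖ ^ 2 = p.re ^ 2 + p.imI ^ 2 + p.imJ ^ 2 + p.imK ^ 2 := by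
    rw [pow_two, ← Quaternion.normSq_eq_norm_mul_self, Quaternion.normSq_def']
  have key : 4 * δ ^ 2 * ((‖p‖ ^ 2 + δ ^ 2) ^ 3)⁻¹ =
      4 * ((‖p‖ ^ 2 + δ ^ 2) ^ 2)⁻¹ - 4 * ‖p‖ ^ 2 * ((‖p‖ ^ 2 + δ ^ 2) ^ 3)⁻¹ := by
    field_simp
    ring
  rw [key]
  simp only [Dr, (hasFDerivAt_regKernel hδ p).fderiv, _root_.add_apply,
    _root_.smul_apply, ContinuousLinearMap.smulRight_apply, innerSL_apply_apply,
    Quaternion.inner_def, ContinuousLinearEquiv.coe_coe, starL'_apply]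
  generalize ((‖p‖ ^ 2 + δ ^ 2) ^ 2)⁻¹ = a
  generalize ((‖p‖ ^ 2 + δ ^ 2) ^ 3)⁻¹ = b
  generalize ‖p‖ ^ 2 = S at hn
  ext <;> simp <;> try rw [hn]
  all_goals ring

theorem continuous_Dl {g : ℍ[ℝ] → ℍ[ℝ]} (hg : ContDiff ℝ 1 g) : Continuous (Dl g) := by
  have h := hg.continuous_fderiv one_ne_zero
  unfold Dl
  fun_prop

theorem HasCompactSupport.Dl {g : ℍ[ℝ] → ℍ[ℝ]} (hg : HasCompactSupport g) :
    HasCompactSupport (Dl g) :=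
  (hg.fderiv ℝ).comp_left
    (g := fun L : ℍ[ℝ] →L[ℝ] ℍ[ℝ] ↦ L 1 + qI * L qI + qJ * L qJ + qK * L qK) (by simp)

theorem Dl_comp_add_right (g : ℍ[ℝ] → ℍ[ℝ]) (q u : ℍ[ℝ]) :
    Dl (fun u ↦ g (u + q)) u = Dl g (u + q) := by
  simp [Dl, fderiv_comp_add_right]

theorem Filter.EventuallyEq.Dl_eq {f g : ℍ[ℝ] → ℍ[ℝ]} {q : ℍ[ℝ]} (h : f =ᶠ[𝓝 q] g) :
    Dl f q = Dl g q := by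
  simp only [Dl, h.fderiv_eq]

theorem integral_add_add_add {α G : Type*} [MeasurableSpace α] {μ : Measure α}
    [NormedAddCommGroup G] [NormedSpace ℝ G] {F₁ F₂ F₃ F₄ : α → G} (h₁ : Integrable F₁ μ)
    (h₂ : Integrable F₂ μ) (h₃ : Integrable F₃ μ) (h₄ : Integrable F₄ μ) :
    ∫ p, F₁ p + F₂ p + F₃ p + F₄ p ∂μ =
      ∫ p, F₁ p ∂μ + ∫ p, F₂ p ∂μ + ∫ p, F₃ p ∂μ + ∫ p, F₄ p ∂μ := by
  have h₁₂ : Integrable (fun p ↦ F₁ p + F₂ p) μ := h₁.add h₂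
  have h₁₂₃ : Integrable (fun p ↦ F₁ p + F₂ p + F₃ p) μ := h₁₂.add h₃
  rw [integral_add h₁₂₃ h₄, integral_add h₁₂ h₃, integral_add h₁ h₂]

section

variable (μ : Measure ℍ[ℝ]) [μ.IsAddHaarMeasure]

/-- Integration by parts for the Fueter operators. -/
theorem integral_mul_Dl_eq_neg_integral_Dr_mul {k g : ℍ[ℝ] → ℍ[ℝ]} (hk : ContDiff ℝ 1 k)
    (hg : ContDiff ℝ 1 g) (hgc : HasCompactSupport g) :
    ∫ p, k p * Dl g p ∂μ = -∫ p, Dr k p * g p ∂μ := by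
  have hk' := hk.continuous_fderiv one_ne_zero
  have hg' := hg.continuous_fderiv one_ne_zero
  have hkc := hk.continuous
  have hgcont := hg.continuous
  have i1 (a v : ℍ[ℝ]) : Integrable (fun p ↦ k p * (a * fderiv ℝ g p v)) μ := by
    refine Continuous.integrable_of_hasCompactSupport (by fun_prop) ?_
    exact ((hgc.fderiv_apply ℝ v).mul_left (f := fun _ ↦ a)).mul_left
  have i2 (a v : ℍ[ℝ]) : Integrable (fun p ↦ fderiv ℝ k p v * a * g p) μ :=
    Continuous.integrable_of_hasCompactSupport (by fun_prop) hgc.mul_left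
  have i3 (a : ℍ[ℝ]) : Integrable (fun p ↦ k p * (a * g p)) μ := by
    refine Continuous.integrable_of_hasCompactSupport (by fun_prop) ?_
    exact (hgc.mul_left (f := fun _ ↦ a)).mul_left
  have parts (a v : ℍ[ℝ]) :
      ∫ p, k p * (a * fderiv ℝ g p v) ∂μ = -∫ p, fderiv ℝ k p v * a * g p ∂μ := by
    have := integral_bilinear_fderiv_right_eq_neg_left_of_integrable (μ := μ) (f := k) (g := g)
      (v := v) (B := (ContinuousLinearMap.compL ℝ ℍ[ℝ] ℍ[ℝ] ℍ[ℝ]).flip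
        (ContinuousLinearMap.mul ℝ ℍ[ℝ] a) ∘L ContinuousLinearMap.mul ℝ ℍ[ℝ])
      (by simpa [← mul_assoc] using i2 a v) (by simpa using i1 a v) (by simpa using i3 a)
      (fun p _ ↦ hk.differentiable one_ne_zero p) (fun p _ ↦ hg.differentiable one_ne_zero p)
    simpa [← mul_assoc] using this
  have e1 : ∀ p, k p * Dl g p = k p * (1 * fderiv ℝ g p 1) + k p * (qI * fderiv ℝ g p qI) +
      k p * (qJ * fderiv ℝ g p qJ) + k p * (qK * fderiv ℝ g p qK) := fun p ↦ by
    simp only [Dl, mul_add, one_mul]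
  have e2 : ∀ p, Dr k p * g p = fderiv ℝ k p 1 * 1 * g p + fderiv ℝ k p qI * qI * g p +
      fderiv ℝ k p qJ * qJ * g p + fderiv ℝ k p qK * qK * g p := fun p ↦ by
    simp only [Dr, add_mul, mul_one]
  simp_rw [e1, e2]
  rw [integral_add_add_add (i1 _ _) (i1 _ _) (i1 _ _) (i1 _ _),
    integral_add_add_add (i2 _ _) (i2 _ _) (i2 _ _) (i2 _ _)]
  simp only [parts]
  abel

theorem integrable_inv_one_add_norm_sq_cube :
    Integrable (fun u : ℍ[ℝ] ↦ 4 * ((‖u‖ ^ 2 + 1) ^ 3)⁻¹) μ := by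
  have h := integrable_rpow_neg_one_add_norm_sq (E := ℍ[ℝ]) (μ := μ) (r := 6)
    (by rw [Quaternion.finrank_eq_four]; norm_num)
  refine (h.const_mul 4).congr (Eventually.of_forall fun u ↦ ?_)
  have : 0 ≤ 1 + ‖u‖ ^ 2 := by positivity
  simp only
  rw [show (-6 / 2 : ℝ) = -(3 : ℕ) by norm_num, Real.rpow_neg this, Real.rpow_natCast, add_comm]

theorem integral_inv_one_add_norm_sq_cube_pos :
    0 < ∫ u : ℍ[ℝ], 4 * ((‖u‖ ^ 2 + 1) ^ 3)⁻¹ ∂μ := by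
  rw [integral_pos_iff_support_of_nonneg (fun u ↦ by positivity)
    (integrable_inv_one_add_norm_sq_cube μ)]
  have : (Function.support fun u : ℍ[ℝ] ↦ 4 * ((‖u‖ ^ 2 + 1) ^ 3)⁻¹) = Set.univ := by
    ext u
    simp only [Function.mem_support, Set.mem_univ, iff_true]
    positivity
  rw [this]
  exact Measure.measure_univ_pos.2 (NeZero.ne μ)

/-- The functions `Dr (regKernel δ)` form an approximate identity, up to a constant. -/
theorem tendsto_integral_Dr_regKernel_mul {g : ℍ[ℝ] → ℍ[ℝ]} (hg : Continuous g)
    (hgc : HasCompactSupport g) :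
    Tendsto (fun δ : ℝ ↦ ∫ p, Dr (regKernel δ) p * g p ∂μ) (𝓝[>] 0)
      (𝓝 ((∫ u : ℍ[ℝ], 4 * ((‖u‖ ^ 2 + 1) ^ 3)⁻¹ ∂μ) • g 0)) := by
  obtain ⟨M, hM⟩ := hg.bounded_above_of_compact_support hgc
  have hscale : ∀ δ : ℝ, 0 < δ → ∫ p, Dr (regKernel δ) p * g p ∂μ =
      ∫ u : ℍ[ℝ], (4 * ((‖u‖ ^ 2 + 1) ^ 3)⁻¹) • g (δ • u) ∂μ := by
    intro δ hδ
    have h := Measure.integral_comp_smul_of_nonneg μ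
      (fun p ↦ Dr (regKernel δ) p * g p) δ (hR := hδ.le)
    rw [Quaternion.finrank_eq_four, eq_inv_smul_iff₀ (by positivity), ← integral_smul] at h
    rw [← h]
    congr 1 with u : 1
    rw [Dr_regKernel hδ.ne', Quaternion.coe_mul_eq_smul, smul_smul, norm_smul, Real.norm_eq_abs,
      mul_pow, sq_abs]
    congr 1
    have : 0 < ‖u‖ ^ 2 + 1 := by positivity
    rw [show δ ^ 2 * ‖u‖ ^ 2 + δ ^ 2 = δ ^ 2 * (‖u‖ ^ 2 + 1) by ring]
    field_simp
  rw [← integral_smul_const]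
  refine Tendsto.congr' (f₁ := fun δ : ℝ ↦
    ∫ u : ℍ[ℝ], (4 * ((‖u‖ ^ 2 + 1) ^ 3)⁻¹) • g (δ • u) ∂μ) ?_ ?_
  · filter_upwards [self_mem_nhdsWithin] with δ hδ using (hscale δ hδ).symm
  refine tendsto_integral_filter_of_dominated_convergence
    (fun u ↦ 4 * ((‖u‖ ^ 2 + 1) ^ 3)⁻¹ * M) ?_ ?_
    ((integrable_inv_one_add_norm_sq_cube μ).mul_const M) ?_
  · refine Eventually.of_forall fun δ ↦ ?_
    exact (integrable_inv_one_add_norm_sq_cube μ).aestronglyMeasurable.smul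
      (by fun_prop : Continuous fun u ↦ g (δ • u)).aestronglyMeasurable
  · refine Eventually.of_forall fun δ ↦ Eventually.of_forall fun u ↦ ?_
    rw [norm_smul, Real.norm_of_nonneg (by positivity)]
    gcongr
    exact hM _
  · refine Eventually.of_forall fun u ↦ ?_
    have : Continuous fun δ : ℝ ↦ (4 * ((‖u‖ ^ 2 + 1) ^ 3)⁻¹) • g (δ • u) := by fun_prop
    simpa using (this.tendsto 0).mono_left nhdsWithin_le_nhds

theorem norm_regKernel_le (δ : ℝ) (u : ℍ[ℝ]) : ‖regKernel δ u‖ ≤ (‖u‖ ^ 3)⁻¹ := by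
  rcases eq_or_ne u 0 with rfl | hu
  · simp [regKernel]
  have hu' : 0 < ‖u‖ := norm_pos_iff.2 hu
  rw [regKernel, norm_smul, norm_star, Real.norm_of_nonneg (by positivity)]
  calc ((‖u‖ ^ 2 + δ ^ 2) ^ 2)⁻¹ * ‖u‖ ≤ ((‖u‖ ^ 2) ^ 2)⁻¹ * ‖u‖ := by
        gcongr
        linarith [sq_nonneg δ]
    _ = (‖u‖ ^ 3)⁻¹ := by field_simp

theorem tendsto_regKernel {u : ℍ[ℝ]} (hu : u ≠ 0) :
    Tendsto (fun δ ↦ regKernel δ u) (𝓝 0) (𝓝 (regKernel 0 u)) := by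
  refine ContinuousAt.tendsto ?_
  unfold regKernel
  have hc : Continuous fun δ : ℝ ↦ (‖u‖ ^ 2 + δ ^ 2) ^ 2 := by fun_prop
  refine (hc.continuousAt.inv₀ ?_).smul continuousAt_const
  have : 0 < ‖u‖ := norm_pos_iff.2 hu
  positivity

theorem tendsto_integral_regKernel_mul {W : ℍ[ℝ] → ℍ[ℝ]} (hW : Continuous W)
    (hWc : HasCompactSupport W) (h0 : (0 : ℍ[ℝ]) ∉ tsupport W) :
    Tendsto (fun δ : ℝ ↦ ∫ p, regKernel δ p * W p ∂μ) (𝓝[>] 0)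
      (𝓝 (∫ p, regKernel 0 p * W p ∂μ)) := by
  refine tendsto_integral_filter_of_dominated_convergence (fun p ↦ (‖p‖ ^ 3)⁻¹ * ‖W p‖)
    ?_ ?_ ?_ ?_
  · filter_upwards [self_mem_nhdsWithin] with δ hδ
    exact ((contDiff_regKernel (ne_of_gt hδ)).continuous.mul hW).aestronglyMeasurable
  · refine Eventually.of_forall fun δ ↦ Eventually.of_forall fun p ↦ ?_
    rw [norm_mul]
    gcongr
    exact norm_regKernel_le δ p
  · refine (integrableOn_iff_integrable_of_support_subset (s := tsupport W) ?_).1 ?_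
    · exact fun p hp ↦ subset_tsupport W fun h ↦ hp (by simp [h])
    · refine ContinuousOn.integrableOn_compact hWc ?_
      refine ContinuousOn.mul (ContinuousOn.inv₀ (by fun_prop) fun p hp ↦ ?_) (by fun_prop)
      have : p ≠ 0 := fun h ↦ h0 (h ▸ hp)
      positivity
  · refine Eventually.of_forall fun p ↦ ?_
    rcases eq_or_ne p 0 with rfl | hp
    · simp [image_eq_zero_of_notMem_tsupport h0]
    · exact ((tendsto_regKernel hp).mono_left nhdsWithin_le_nhds).mul_const _

/-- Cauchy–Pompeiu type representation of a compactly supported function away from the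
support of its Fueter derivative. -/
theorem integral_smul_eq_neg_integral_regKernel_mul_Dl {g : ℍ[ℝ] → ℍ[ℝ]} (hg : ContDiff ℝ 1 g)
    (hgc : HasCompactSupport g) {q : ℍ[ℝ]} (hq : q ∉ tsupport (Dl g)) :
    (∫ u : ℍ[ℝ], 4 * ((‖u‖ ^ 2 + 1) ^ 3)⁻¹ ∂μ) • g q =
      -∫ p, regKernel 0 (p - q) * Dl g p ∂μ := by
  set h : ℍ[ℝ] → ℍ[ℝ] := fun u ↦ g (u + q) with h_def
  have hh : ContDiff ℝ 1 h := hg.comp (contDiff_id.add contDiff_const)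
  have hhc : HasCompactSupport h := hgc.comp_homeomorph (Homeomorph.addRight q)
  have hDl : Dl h = Dl g ∘ Homeomorph.addRight q := funext fun u ↦ Dl_comp_add_right g q u
  have h0 : (0 : ℍ[ℝ]) ∉ tsupport (Dl h) := by
    rw [hDl, tsupport_comp_eq_preimage]
    simpa using hq
  have l1 := tendsto_integral_regKernel_mul μ (continuous_Dl hh) hhc.Dl h0
  have l2 := (tendsto_integral_Dr_regKernel_mul μ hh.continuous hhc).neg
  have heq := tendsto_nhds_unique_of_eventuallyEq l1 l2 (by
    filter_upwards [self_mem_nhdsWithin] with δ hδ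
    exact integral_mul_Dl_eq_neg_integral_Dr_mul μ (contDiff_regKernel (ne_of_gt hδ)) hh hhc)
  have hshift := integral_add_right_eq_self (μ := μ)
    (fun p ↦ regKernel 0 (p - q) * Dl g p) q
  simp only [add_sub_cancel_right] at hshift
  rw [← hshift]
  simp only [hDl, Function.comp_apply, Homeomorph.coe_addRight] at heq
  rw [heq, neg_neg, h_def]
  simp

theorem regKernel_zero_eq (u : ℍ[ℝ]) : regKernel 0 u = u⁻¹ * (u⁻¹ * star u⁻¹) := by
  rw [regKernel, Quaternion.self_mul_star, Quaternion.normSq_inv, Quaternion.inv_def,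
    Quaternion.normSq_eq_norm_mul_self, ← Quaternion.coe_commutes, Quaternion.coe_mul_eq_smul,
    smul_smul]
  congr 1
  rw [← mul_inv]
  ring

theorem analyticAt_integral_regKernel_mul {W : ℍ[ℝ] → ℍ[ℝ]} (hW : Continuous W)
    (hWc : HasCompactSupport W) {q : ℍ[ℝ]} (hq : q ∉ tsupport W) :
    AnalyticAt ℝ (fun q ↦ ∫ p, regKernel 0 (p - q) * W p ∂μ) q := by
  set K := tsupport W with K_def
  have : CompactSpace K := isCompact_iff_compactSpace.1 hWc
  have : StarModule ℝ C(K, ℍ[ℝ]) := ⟨fun r h ↦ by ext1 p; exact star_smul r (h p)⟩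
  have : IsFiniteMeasure (μ.comap ((↑) : K → ℍ[ℝ])) := ⟨by
    rw [(MeasurableEmbedding.subtype_coe hWc.measurableSet).comap_apply]
    simpa using hWc.measure_lt_top⟩
  let Φ : ℍ[ℝ] → C(K, ℍ[ℝ]) := fun q ↦ ⟨Subtype.val, continuous_subtype_val⟩ -
    ContinuousMap.const K q
  let WK : C(K, ℍ[ℝ]) := ⟨fun p ↦ W p, by fun_prop⟩
  let L : C(K, ℍ[ℝ]) →L[ℝ] ℍ[ℝ] := LinearMap.mkContinuousOfExistsBound
    { toFun := fun h ↦ ∫ p, h p ∂(μ.comap ((↑) : K → ℍ[ℝ]))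
      map_add' := fun h₁ h₂ ↦ integral_add (h₁.continuous.integrable_of_hasCompactSupport
        (HasCompactSupport.of_compactSpace _)) (h₂.continuous.integrable_of_hasCompactSupport
        (HasCompactSupport.of_compactSpace _))
      map_smul' := fun c h ↦ integral_smul c _ }
    ⟨(μ.comap ((↑) : K → ℍ[ℝ])).real Set.univ, fun h ↦ by
      rw [mul_comm]
      exact norm_integral_le_of_norm_le_const (Eventually.of_forall h.norm_coe_le_norm)⟩
  have hΦ : AnalyticAt ℝ Φ q := by
    refine analyticAt_const.sub ?_
    exact (ContinuousLinearMap.const ℝ K : ℍ[ℝ] →L[ℝ] C(K, ℍ[ℝ])).analyticAt q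
  have inv_apply : ∀ q ∉ K, IsUnit (Φ q) ∧ ∀ p : K, Ring.inverse (Φ q) p = (p - q : ℍ[ℝ])⁻¹ := by
    intro q hq
    have hne (p : K) : Φ q p ≠ 0 := sub_ne_zero.2 fun h : (p : ℍ[ℝ]) = q ↦ hq (h ▸ p.2)
    let v : C(K, ℍ[ℝ]) := ⟨fun p ↦ (Φ q p)⁻¹, (Φ q).continuous.inv₀ hne⟩
    let U : C(K, ℍ[ℝ])ˣ := ⟨Φ q, v, by ext1 p; exact mul_inv_cancel₀ (hne p),
      by ext1 p; exact inv_mul_cancel₀ (hne p)⟩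
    exact ⟨U.isUnit, fun p ↦ DFunLike.congr_fun (Ring.inverse_unit U) p⟩
  have hinv : AnalyticAt ℝ (fun q ↦ Ring.inverse (Φ q)) q := by
    obtain ⟨U, hU⟩ := (inv_apply q hq).1
    exact AnalyticAt.comp (hU ▸ analyticAt_inverse U) hΦ
  have hstar : AnalyticAt ℝ (fun q ↦ star (Ring.inverse (Φ q))) q :=
    ((starL' ℝ : C(K, ℍ[ℝ]) ≃L[ℝ] C(K, ℍ[ℝ])) : C(K, ℍ[ℝ]) →L[ℝ] C(K, ℍ[ℝ])).analyticAt _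
      |>.comp hinv
  have hL := (L.analyticAt _).comp ((hinv.mul (hinv.mul hstar)).mul
    (analyticAt_const (v := WK)))
  refine hL.congr ?_
  filter_upwards [(isClosed_tsupport W).isOpen_compl.mem_nhds hq] with q hq
  have h1 : ∫ p, regKernel 0 (p - q) * W p ∂μ = ∫ p in K, regKernel 0 (p - q) * W p ∂μ := by
    refine (setIntegral_eq_integral_of_forall_compl_eq_zero fun p hp ↦ ?_).symm
    rw [image_eq_zero_of_notMem_tsupport hp, mul_zero]
  rw [h1, ← integral_subtype_comap hWc.measurableSet]
  refine integral_congr_ae (Eventually.of_forall fun p ↦ ?_)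
  simp only [ContinuousMap.mul_apply, ContinuousMap.star_apply, (inv_apply q hq).2,
    regKernel_zero_eq, Pi.mul_apply]
  rfl

end

/-- **F-regular functions are (real-)analytic.** -/
theorem F_regular_is_analytic (Ω : Set ℍ[ℝ]) (hΩ : IsOpen Ω)
    (f : ℍ[ℝ] → ℍ[ℝ]) (hf : ContDiffOn ℝ 1 f Ω) (hreg : ∀ q ∈ Ω, Dl f q = 0) :
    AnalyticOn ℝ f Ω := by
  intro q hq
  refine AnalyticAt.analyticWithinAt ?_
  obtain ⟨r, hr, hball⟩ := nhds_basis_closedBall.mem_iff.1 (hΩ.mem_nhds hq)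
  let χ : ContDiffBump q := ⟨r / 2, r, half_pos hr, half_lt_self hr⟩
  set g : ℍ[ℝ] → ℍ[ℝ] := fun p ↦ χ p • f p
  have hg : ContDiff ℝ 1 g := by
    refine contDiff_iff_contDiffAt.2 fun p ↦ ?_
    by_cases hp : p ∈ Ω
    · exact χ.contDiffAt.smul (hf.contDiffAt (hΩ.mem_nhds hp))
    · have hp' : p ∉ tsupport χ := fun h ↦ hp (hball (χ.tsupport_eq ▸ h))
      refine (contDiffAt_const (c := 0)).congr_of_eventuallyEq ?_
      filter_upwards [notMem_tsupport_iff_eventuallyEq.1 hp'] with x hx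
      simp [g, hx]
  have hgc : HasCompactSupport g := χ.hasCompactSupport.smul_right
  have hgf : ∀ p ∈ ball q (r / 2), g =ᶠ[𝓝 p] f := fun p hp ↦ by
    filter_upwards [χ.eventuallyEq_one_of_mem_ball hp] with x hx
    simp [g, hx]
  have hsupp : ∀ p ∈ ball q (r / 2), p ∉ tsupport (Dl g) := fun p hp ↦ by
    rw [notMem_tsupport_iff_eventuallyEq]
    filter_upwards [isOpen_ball.mem_nhds hp] with x hx
    rw [(hgf x hx).Dl_eq]
    exact hreg x (hball (ball_subset_closedBall (ball_subset_ball (half_le_self hr.le) hx)))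
  have hq' : q ∈ ball q (r / 2) := mem_ball_self (half_pos hr)
  let μ : Measure ℍ[ℝ] := Measure.addHaar
  set C := ∫ u : ℍ[ℝ], 4 * ((‖u‖ ^ 2 + 1) ^ 3)⁻¹ ∂μ
  have hC : C ≠ 0 := (integral_inv_one_add_norm_sq_cube_pos μ).ne'
  refine (((analyticAt_integral_regKernel_mul μ (continuous_Dl hg) hgc.Dl
    (hsupp q hq')).neg).const_smul (c := C⁻¹)).congr ?_
  filter_upwards [isOpen_ball.mem_nhds hq'] with p hp
  simp only [Pi.smul_apply, Pi.neg_apply]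
  rw [← (hgf p hp).eq_of_nhds, eq_comm, eq_inv_smul_iff₀ hC]
  exact integral_smul_eq_neg_integral_regKernel_mul_Dl μ hg hgc (hsupp p hp)
end
end

section
/- Spherical decomposition of the Fueter operator: Let f : ℍ → ℍ be real-differentiable at a point q ∈ ℍ lying off the plane {t + zk : t, z ∈ ℝ} (i.e. with x(q)² + y(q)² > 0). Then (D_l f)(q) = ∂f/∂t + ι·(∂f/∂r) − (1/r)·(∂f/∂ι), where r = |Im q|, ι = Im q/|Im q|, and ∂f/∂t, ∂f/∂r, ∂f/∂ι are as defined from the spherical coordinates of ι. -/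
open MeasureTheory Metric Filter
open scoped Quaternion Topology

noncomputable section

/-- `r(q) = |Im q|`. -/
def rQ (q : ℍ[ℝ]) : ℝ := ‖q.im‖

/-- `ι(q) = Im q / |Im q|`. -/
def iotaQ (q : ℍ[ℝ]) : ℍ[ℝ] := (rQ q)⁻¹ • q.im

/-- `sqrt(x² + y²)`, so that `sin β = sXY q / r q`. -/
def sXY (q : ℍ[ℝ]) : ℝ := Real.sqrt (q.imI ^ 2 + q.imJ ^ 2)

/-- `ι_α = (−sin α sin β)i + (cos α sin β)j`, expressed through the coordinates of `q`. -/
def iotaA (q : ℍ[ℝ]) : ℍ[ℝ] := ⟨0, -(q.imJ / rQ q), q.imI / rQ q, 0⟩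

/-- `ι_β = (cos α cos β)i + (sin α cos β)j − (sin β)k`, expressed through the
coordinates of `q`. -/
def iotaB (q : ℍ[ℝ]) : ℍ[ℝ] :=
  ⟨0, q.imI * q.imK / (sXY q * rQ q), q.imJ * q.imK / (sXY q * rQ q), -(sXY q / rQ q)⟩

/-- `∂f/∂ι := ι_α⁻¹·(∂f/∂α) + ι_β⁻¹·(∂f/∂β)`, where `∂f/∂α = f'(q)(r·ι_α)` and
`∂f/∂β = f'(q)(r·ι_β)`. -/
def dIota (f : ℍ[ℝ] → ℍ[ℝ]) (q : ℍ[ℝ]) : ℍ[ℝ] :=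
  (iotaA q)⁻¹ * fderiv ℝ f q (rQ q • iotaA q) + (iotaB q)⁻¹ * fderiv ℝ f q (rQ q • iotaB q)

/-- The plane `{t + zk : t, z ∈ ℝ} ⊆ ℍ`. -/
def tkPlane : Set ℍ[ℝ] := {q | q.imI = 0 ∧ q.imJ = 0}

/-- A quaternion with vanishing real part, expanded in the imaginary units. -/
theorem eq_smul_units_of_re_eq_zero {v : ℍ[ℝ]} (hv : v.re = 0) :
    v = v.imI • qI + v.imJ • qJ + v.imK • qK := by
  ext <;> simp only [Quaternion.re_add, Quaternion.imI_add, Quaternion.imJ_add, Quaternion.imK_add,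
    Quaternion.re_smul, Quaternion.imI_smul, Quaternion.imJ_smul, Quaternion.imK_smul, smul_eq_mul] <;>
    simp [qI, qJ, qK, hv]

theorem mul_map_eq_sum_units (L : ℍ[ℝ] →L[ℝ] ℍ[ℝ]) {v : ℍ[ℝ]} (hv : v.re = 0) :
    v * L v =
      (v.imI * v.imI) • (qI * L qI) + (v.imI * v.imJ) • (qI * L qJ) +
        (v.imI * v.imK) • (qI * L qK) + (v.imJ * v.imI) • (qJ * L qI) +
        (v.imJ * v.imJ) • (qJ * L qJ) + (v.imJ * v.imK) • (qJ * L qK) +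
        (v.imK * v.imI) • (qK * L qI) + (v.imK * v.imJ) • (qK * L qJ) +
        (v.imK * v.imK) • (qK * L qK) := by
  conv_lhs => rw [eq_smul_units_of_re_eq_zero hv]
  simp only [map_add, map_smul, add_mul, mul_add, smul_mul_assoc, mul_smul_comm]
  module

theorem inv_mul_map_smul (L : ℍ[ℝ] →L[ℝ] ℍ[ℝ]) {v : ℍ[ℝ]} (hv : v.re = 0) (r : ℝ) :
    v⁻¹ * L (r • v) = -((r * (Quaternion.normSq v)⁻¹) • (v * L v)) := by
  have hstar : star v = -v := by ext <;> simp [hv]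
  rw [Quaternion.inv_def, hstar, map_smul, smul_mul_assoc, mul_smul_comm, neg_mul]
  module

theorem rQ_sq (q : ℍ[ℝ]) : rQ q ^ 2 = q.imI ^ 2 + q.imJ ^ 2 + q.imK ^ 2 := by
  rw [rQ, sq, ← Quaternion.normSq_eq_norm_mul_self, Quaternion.normSq_def']
  simp

theorem sXY_sq (q : ℍ[ℝ]) : sXY q ^ 2 = q.imI ^ 2 + q.imJ ^ 2 :=
  Real.sq_sqrt (by positivity)

/-- **Spherical decomposition of the Fueter operator.** Off the plane `{t + zk}`,
`D_l f = ∂f/∂t + ι·(∂f/∂r) − (1/r)·(∂f/∂ι)`. -/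
theorem fueter_spherical_decomposition (f : ℍ[ℝ] → ℍ[ℝ]) (q : ℍ[ℝ])
    (hf : DifferentiableAt ℝ f q) (hq : 0 < q.imI ^ 2 + q.imJ ^ 2) :
    Dl f q = fderiv ℝ f q 1 + iotaQ q * fderiv ℝ f q (iotaQ q) - (rQ q)⁻¹ • dIota f q := by
  have hs : sXY q ≠ 0 := (Real.sqrt_pos.2 hq).ne'
  have hs2 := sXY_sq q
  have hr2 := rQ_sq q
  have hr : rQ q ≠ 0 := fun h => by
    rw [h] at hr2
    nlinarith [sq_nonneg q.imK]
  have hnA : Quaternion.normSq (iotaA q) = sXY q ^ 2 / rQ q ^ 2 := by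
    rw [Quaternion.normSq_def', hs2]
    simp only [iotaA]
    ring
  have hnB : Quaternion.normSq (iotaB q) = 1 := by
    rw [Quaternion.normSq_def']
    simp only [iotaB]
    field_simp
    grind
  rw [Dl, dIota, inv_mul_map_smul _ (by rfl), inv_mul_map_smul _ (by rfl), hnA, hnB,
    mul_map_eq_sum_units _ (v := iotaQ q) (by simp [iotaQ]),
    mul_map_eq_sum_units _ (v := iotaA q) (by rfl),
    mul_map_eq_sum_units _ (v := iotaB q) (by rfl)]
  simp only [iotaQ, iotaA, iotaB, Quaternion.imI_smul, Quaternion.imJ_smul,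
    Quaternion.imK_smul, Quaternion.imI_im, Quaternion.imJ_im, Quaternion.imK_im, smul_eq_mul]
  match_scalars <;> field_simp <;> grind
end
end
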